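/- (UnanimousVoteCutGreedyMin is not a moving-phantom mechanism.) Let n = 2 and m = 3. Consider the profiles P₁ = ((0.84, 0.16, 0), (0.7, 0.3, 0)) and P₂ = ((0.82, 0.18, 0), (0.7, 0.3, 0)). Then: (i) c̃((0.84,0.16,0),(0.7,0.3,0)) = (0.8, 0.18, 0.02) and c̃((0.7,0.3,0),(0.84,0.16,0)) = (0.7,0.3,0), and every GreedyMin aggregate of ((0.8,0.18,0.02),(0.7,0.3,0)) equals a₁ = (0.7, 0.18, 0.12); similarly, c̃((0.82,0.18,0),(0.7,0.3,0)) = (0.8, 0.19, 0.01), and every GreedyMin aggregate of ((0.8,0.19,0.01),(0.7,0.3,0)) equals a₂ = (0.7, 0.19, 0.11); (ii) there is no phantom system (f₀, f₁, f₂) for 2 voters and no t₁, t₂ ∈ [0,1] such that, for each l ∈ {1,2} and every j ∈ {1,2,3}, (a_l)_j is the median of the multiset {f₀(t_l), f₁(t_l), f₂(t_l), p^{(l)}_{1,j}, p^{(l)}_{2,j}}, where (p^{(l)}_1, p^{(l)}_2) = P_l. -/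

import Mathlib

open scoped Classical BigOperators

/-- The standard simplex Δ^{m-1} as a subset of ℝ^m. -/
def simplex (m : ℕ) : Set (Fin m → ℝ) :=
  {x | (∀ j, 0 ≤ x j) ∧ ∑ j, x j = 1}

/-- The median of a multiset of odd cardinality: the middle element of its sorted list. -/
noncomputable def msMedian (M : Multiset ℝ) : ℝ :=
  (M.sort (· ≤ ·)).getD (M.card / 2) 0

/-- The 2n+1 element multiset {f_0(t), …, f_n(t), p_{1,j}, …, p_{n,j}}. -/
def phantomMS {n m : ℕ} (f : Fin (n + 1) → ℝ → ℝ) (P : Fin n → Fin m → ℝ)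
    (t : ℝ) (j : Fin m) : Multiset ℝ :=
  (Finset.univ.val.map fun k => f k t) + (Finset.univ.val.map fun i => P i j)

/-- The GreedyMin phantom system: f_0(t) = min(2t, 1), f_1 = … = f_n = max(0, 2t-1). -/
noncomputable def gminPhantom (n : ℕ) : Fin (n + 1) → ℝ → ℝ :=
  fun k t => if k = 0 then min (2 * t) 1 else max 0 (2 * t - 1)

/-- The GreedyMin medians med_j(t). -/
noncomputable def gminMed {n m : ℕ} (P : Fin n → Fin m → ℝ) (t : ℝ) : Fin m → ℝ :=
  fun j => msMedian (phantomMS (gminPhantom n) P t j)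

/-- t is a GreedyMin normalization time if t ∈ [0,1] and the medians sum to 1;
the associated GreedyMin aggregate is gminMed P t. -/
noncomputable def IsGminNormTime {n m : ℕ} (P : Fin n → Fin m → ℝ) (t : ℝ) : Prop :=
  t ∈ Set.Icc (0 : ℝ) 1 ∧ ∑ j, gminMed P t j = 1

/-- The partial cutoff c̃(v,w): if v has a coordinate k above 0.8 (unique on the
simplex, and the maximizing coordinate), reduce it by
γ(v,w) = (v_k - 0.8)·max(0, min((0.8 - w_k)/0.1, 1)) and redistribute γ(v,w) evenly
over the other two coordinates; otherwise c̃(v,w) = v. -/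
noncomputable def ctilde (v w : Fin 3 → ℝ) : Fin 3 → ℝ :=
  if h : ∃ k, (8 / 10 : ℝ) < v k then
    fun j =>
      if j = Classical.choose h then
        v j - (v (Classical.choose h) - 8 / 10) *
          max 0 (min ((8 / 10 - w (Classical.choose h)) / (1 / 10)) 1)
      else
        v j + (v (Classical.choose h) - 8 / 10) *
          max 0 (min ((8 / 10 - w (Classical.choose h)) / (1 / 10)) 1) / 2
  else v

/-- A phantom system for n voters: n+1 continuous non-decreasing functions
[0,1] → [0,1] with f_k(0) = 0, f_k(1) = 1, ordered f_0 ≥ f_1 ≥ … ≥ f_n pointwise. -/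
def IsPhantomSystem (n : ℕ) (f : Fin (n + 1) → ℝ → ℝ) : Prop :=
  (∀ k, ContinuousOn (f k) (Set.Icc 0 1)) ∧
  (∀ k, MonotoneOn (f k) (Set.Icc 0 1)) ∧
  (∀ k, Set.MapsTo (f k) (Set.Icc 0 1) (Set.Icc 0 1)) ∧
  (∀ k, f k 0 = 0) ∧ (∀ k, f k 1 = 1) ∧
  (∀ t ∈ Set.Icc (0 : ℝ) 1, ∀ k l : Fin (n + 1), k ≤ l → f l t ≤ f k t)

/-- x is the median of a multiset M of 2k+1 reals: x ∈ M, at least k+1 elements of M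
are ≤ x, and at least k+1 elements of M are ≥ x. -/
def IsMedian (M : Multiset ℝ) (k : ℕ) (x : ℝ) : Prop :=
  x ∈ M ∧ k + 1 ≤ (M.filter fun y => y ≤ x).card ∧ k + 1 ≤ (M.filter fun y => x ≤ y).card

lemma msMedian_coe_of_pairwise {l : List ℝ} (h : l.Pairwise (· ≤ ·)) :
    msMedian (l : Multiset ℝ) = l.getD (l.length / 2) 0 := by
  have : (l : Multiset ℝ).sort (· ≤ ·) = l := by
    rw [Multiset.coe_sort]
    exact List.mergeSort_eq_self (r := (· ≤ ·)) h
  simp only [msMedian, this, Multiset.coe_card]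

lemma msMedian_of_sorted {a b c d e : ℝ} (hab : a ≤ b) (hbc : b ≤ c) (hcd : c ≤ d)
    (hde : d ≤ e) : msMedian ({a} + {b} + {c} + {d} + {e}) = c := by
  have h : ({a} + {b} + {c} + {d} + {e} : Multiset ℝ) = ([a, b, c, d, e] : List ℝ) := rfl
  rw [h, msMedian_coe_of_pairwise]
  · simp
  · simp only [List.pairwise_cons, List.mem_cons, List.not_mem_nil, or_false]
    grind

lemma msMedian_two_equal {u g x y : ℝ} (hgu : g ≤ u) :
    msMedian ({u} + {g} + {g} + {x} + {y}) = max g (min u (min x y)) := by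
  wlog hxy : x ≤ y generalizing x y
  · rw [min_comm x y, ← this (le_of_not_ge hxy), add_right_comm]
  rw [min_eq_left hxy]
  rcases le_total x g with hx | hx
  · rw [max_eq_left (min_le_of_right_le hx)]
    rcases le_total y g with hy | hy
    · exact (congrArg msMedian (by abel)).trans (msMedian_of_sorted hxy hy le_rfl hgu)
    rcases le_total y u with hu | hu
    · exact (congrArg msMedian (by abel)).trans (msMedian_of_sorted hx le_rfl hy hu)
    · exact (congrArg msMedian (by abel)).trans (msMedian_of_sorted hx le_rfl hgu hu)
  · rw [max_eq_right (le_min hgu hx)]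
    rcases le_total u x with hu | hu
    · rw [min_eq_left hu]
      exact (congrArg msMedian (by abel)).trans (msMedian_of_sorted le_rfl hgu hu hxy)
    rw [min_eq_right hu]
    rcases le_total u y with hy | hy
    · exact (congrArg msMedian (by abel)).trans (msMedian_of_sorted le_rfl hx hu hy)
    · exact (congrArg msMedian (by abel)).trans (msMedian_of_sorted le_rfl hx hxy hy)

lemma phantomMS_two {m : ℕ} (f : Fin 3 → ℝ → ℝ) (P : Fin 2 → Fin m → ℝ) (t : ℝ) (j : Fin m) :
    phantomMS f P t j = {f 0 t} + {f 1 t} + {f 2 t} + {P 0 j} + {P 1 j} := rfl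

lemma gminMed_two {m : ℕ} (P : Fin 2 → Fin m → ℝ) {t : ℝ} (ht : t ∈ Set.Icc (0 : ℝ) 1)
    (j : Fin m) :
    gminMed P t j = max (max 0 (2 * t - 1)) (min (min (2 * t) 1) (min (P 0 j) (P 1 j))) := by
  have h : max 0 (2 * t - 1) ≤ min (2 * t) 1 := by
    obtain ⟨h0, h1⟩ := ht
    grind
  rw [gminMed, phantomMS_two, ← msMedian_two_equal h]
  simp [gminPhantom]

/-- GreedyMin on two voters whose minimum vote is `(x, y, 0)` with `y ≤ x`, where the
remaining budget `1 - x - y` is positive and at most `y`. -/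
lemma gminMed_eq_of_min {P : Fin 2 → Fin 3 → ℝ} {x y : ℝ} (h0 : min (P 0 0) (P 1 0) = x)
    (h1 : min (P 0 1) (P 1 1) = y) (h2 : min (P 0 2) (P 1 2) = 0) (hyx : y ≤ x)
    (hpos : x + y < 1) (hle : 1 - x - y ≤ y) {t : ℝ} (ht : IsGminNormTime P t) :
    gminMed P t = ![x, y, 1 - x - y] := by
  obtain ⟨htI, hsum⟩ := ht
  have e0 := gminMed_two P htI 0
  have e1 := gminMed_two P htI 1
  have e2 := gminMed_two P htI 2
  rw [h0] at e0
  rw [h1] at e1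
  rw [h2] at e2
  rw [Fin.sum_univ_three] at hsum
  obtain ⟨ht0, ht1⟩ := htI
  ext j
  fin_cases j <;> simp only [Fin.zero_eta, Fin.mk_one, Fin.reduceFinMk, Matrix.cons_val] <;> grind

lemma ctilde_eq_self {v w : Fin 3 → ℝ} (h : ∀ k, v k ≤ 8 / 10) : ctilde v w = v := by
  rw [ctilde, dif_neg]
  simpa using h

lemma ctilde_of_first {v w : Fin 3 → ℝ} (h0 : 8 / 10 < v 0) (h1 : v 1 ≤ 8 / 10)
    (h2 : v 2 ≤ 8 / 10) (hw : w 0 ≤ 7 / 10) :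
    ctilde v w = ![8 / 10, v 1 + (v 0 - 8 / 10) / 2, v 2 + (v 0 - 8 / 10) / 2] := by
  have h : ∃ k, (8 / 10 : ℝ) < v k := ⟨0, h0⟩
  have hk : Classical.choose h = 0 := by
    have hs := Classical.choose_spec h
    generalize Classical.choose h = k at hs
    fin_cases k
    · rfl
    · exact absurd hs h1.not_gt
    · exact absurd hs h2.not_gt
  have hc : max 0 (min ((8 / 10 - w 0) / (1 / 10)) 1) = 1 := by
    rw [min_eq_right, max_eq_right zero_le_one]
    rw [le_div_iff₀] <;> linarith
  rw [ctilde, dif_pos h]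
  simp only [hk, hc]
  ext j
  fin_cases j <;> simp

/-- The last voted coordinate being `0` for both voters forces the smallest phantom. -/
lemma IsMedian.smallest_phantom_eq {u v w c : ℝ} (hwv : w ≤ v) (hvu : v ≤ u)
    (hc : 0 < c) (h : IsMedian ({u} + {v} + {w} + {0} + {0}) 2 c) : w = c := by
  obtain ⟨-, h1, h2⟩ := h
  simp only [← Multiset.countP_eq_card_filter, Multiset.countP_add, ← Multiset.cons_zero,
    Multiset.countP_cons, Multiset.countP_zero] at h1 h2
  grind

lemma IsMedian.middle_phantom_eq {u v w x y c : ℝ} (hvu : v ≤ u) (hwc : w < c)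
    (hxc : x < c) (hcy : c < y) (h : IsMedian ({u} + {v} + {w} + {x} + {y}) 2 c) : v = c := by
  obtain ⟨-, h1, h2⟩ := h
  simp only [← Multiset.countP_eq_card_filter, Multiset.countP_add, ← Multiset.cons_zero,
    Multiset.countP_cons, Multiset.countP_zero] at h1 h2
  grind

/-- If both voters give `0` to the third alternative, the two smaller phantoms can be read off
from medians of the second and third alternatives. -/
lemma IsPhantomSystem.eq_of_isMedian {f : Fin 3 → ℝ → ℝ} (hf : IsPhantomSystem 2 f)
    {P : Fin 2 → Fin 3 → ℝ} {a : Fin 3 → ℝ} {t : ℝ} (ht : t ∈ Set.Icc (0 : ℝ) 1)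
    (h : ∀ j, IsMedian (phantomMS f P t j) 2 (a j)) (hP0 : P 0 2 = 0) (hP1 : P 1 2 = 0)
    (ha2 : 0 < a 2) (ha : a 2 < a 1) (hl : P 0 1 < a 1) (hr : a 1 < P 1 1) :
    f 1 t = a 1 ∧ f 2 t = a 2 := by
  obtain ⟨-, -, -, -, -, hord⟩ := hf
  have h21 : f 2 t ≤ f 1 t := hord t ht 1 2 (by decide)
  have h10 : f 1 t ≤ f 0 t := hord t ht 0 1 (by decide)
  have hm2 := h 2
  have hm1 := h 1
  rw [phantomMS_two, hP0, hP1] at hm2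
  rw [phantomMS_two] at hm1
  have e2 := hm2.smallest_phantom_eq h21 h10 ha2
  exact ⟨hm1.middle_phantom_eq h10 (e2 ▸ ha) hl hr, e2⟩

/-- UnanimousVoteCutGreedyMin is not a moving-phantom mechanism:
its outputs a₁ and a₂ on the profiles P₁ = ((0.84,0.16,0),(0.7,0.3,0)) and
P₂ = ((0.82,0.18,0),(0.7,0.3,0)) cannot both be realized as medians of any single
phantom system for two voters. -/
theorem stmt19 (p₁ p₂ q₁ a₁ a₂ : Fin 3 → ℝ)
    (hp₁ : p₁ = ![0.84, 0.16, 0]) (hp₂ : p₂ = ![0.7, 0.3, 0])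
    (hq₁ : q₁ = ![0.82, 0.18, 0])
    (ha₁ : a₁ = ![0.7, 0.18, 0.12]) (ha₂ : a₂ = ![0.7, 0.19, 0.11]) :
    (ctilde p₁ p₂ = ![0.8, 0.18, 0.02] ∧
      ctilde p₂ p₁ = p₂ ∧
      (∀ t : ℝ, IsGminNormTime ![![(0.8 : ℝ), 0.18, 0.02], p₂] t →
        gminMed ![![(0.8 : ℝ), 0.18, 0.02], p₂] t = a₁) ∧
      ctilde q₁ p₂ = ![0.8, 0.19, 0.01] ∧
      (∀ t : ℝ, IsGminNormTime ![![(0.8 : ℝ), 0.19, 0.01], p₂] t →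
        gminMed ![![(0.8 : ℝ), 0.19, 0.01], p₂] t = a₂)) ∧
    ¬ ∃ f : Fin 3 → ℝ → ℝ, IsPhantomSystem 2 f ∧
        ∃ t₁ ∈ Set.Icc (0 : ℝ) 1, ∃ t₂ ∈ Set.Icc (0 : ℝ) 1,
          (∀ j, IsMedian (phantomMS f ![p₁, p₂] t₁ j) 2 (a₁ j)) ∧
          (∀ j, IsMedian (phantomMS f ![q₁, p₂] t₂ j) 2 (a₂ j)) := by
  subst hp₁ hp₂ hq₁ ha₁ ha₂
  refine ⟨⟨?_, ?_, fun t ht => ?_, ?_, fun t ht => ?_⟩, ?_⟩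
  · rw [ctilde_of_first] <;> simp <;> norm_num
  · apply ctilde_eq_self
    intro k
    fin_cases k <;> simp <;> norm_num
  · rw [gminMed_eq_of_min (x := 0.7) (y := 0.18) _ _ _ _ _ _ ht] <;> try simp
    all_goals norm_num
  · rw [ctilde_of_first] <;> simp <;> norm_num
  · rw [gminMed_eq_of_min (x := 0.7) (y := 0.19) _ _ _ _ _ _ ht] <;> try simp
    all_goals norm_num
  · rintro ⟨f, hf, t₁, ht₁, t₂, ht₂, h₁, h₂⟩
    obtain ⟨e₁, g₁⟩ := hf.eq_of_isMedian ht₁ h₁ (by simp) (by simp)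
      (by simp; norm_num) (by simp; norm_num) (by simp; norm_num) (by simp; norm_num)
    obtain ⟨e₂, g₂⟩ := hf.eq_of_isMedian ht₂ h₂ (by simp) (by simp)
      (by simp; norm_num) (by simp; norm_num) (by simp; norm_num) (by simp; norm_num)
    simp only [Matrix.cons_val] at e₁ g₁ e₂ g₂
    rcases le_total t₁ t₂ with h | h
    · have := hf.2.1 2 ht₁ ht₂ h
      rw [g₁, g₂] at this
      norm_num at this
    · have := hf.2.1 1 ht₂ ht₁ h
      rw [e₁, e₂] at this
      norm_num at this
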